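/- Let N ≥ 2 and 1 < α < N. For every L¹ function g : ℝ^N → [0,1], setting r = (‖g‖_{L¹}/ω_N)^{1/N}, one has ∫_{ℝ^N} g(y)·|y|^{α−N} dy ≤ ∫_{B(r)} |y|^{α−N} dy. -/

import Mathlib

open MeasureTheory Metric

noncomputable def omegaN (N : ℕ) : ℝ :=
  (volume (ball (0 : EuclideanSpace ℝ (Fin N)) 1)).toReal

/-- The bathtub principle: among functions with values in `[0, 1]` and prescribed integral, the
indicator of a superlevel set of `w` maximizes the integral against `w`. -/
theorem integral_mul_le_setIntegral_of_superlevel {X : Type*} [MeasurableSpace X] {μ : Measure X}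
    {s : Set X} {g w : X → ℝ} {c : ℝ} (hs : MeasurableSet s) (hμs : μ s ≠ ⊤)
    (hg : Integrable g μ) (hg01 : ∀ x, g x ∈ Set.Icc (0 : ℝ) 1) (hw : IntegrableOn w s μ)
    (hw0 : ∀ x, 0 ≤ w x) (hin : ∀ᵐ x ∂μ, x ∈ s → c ≤ w x) (hout : ∀ x, x ∉ s → w x ≤ c)
    (hgs : ∫ x, g x ∂μ = μ.real s) :
    ∫ x, g x * w x ∂μ ≤ ∫ x in s, w x ∂μ := by
  have hone : Integrable (s.indicator fun _ => (1 : ℝ)) μ :=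
    (integrable_indicator_iff hs).2 (integrableOn_const hμs)
  have hsw : Integrable (s.indicator w) μ := (integrable_indicator_iff hs).2 hw
  have hdiff : Integrable (fun x => c * (g x - s.indicator (fun _ => (1 : ℝ)) x)) μ :=
    (hg.sub hone).const_mul c
  calc ∫ x, g x * w x ∂μ
      ≤ ∫ x, (s.indicator w x + c * (g x - s.indicator (fun _ => (1 : ℝ)) x)) ∂μ := by
        refine integral_mono_of_nonneg
          (Filter.Eventually.of_forall fun x => mul_nonneg (hg01 x).1 (hw0 x)) (hsw.add hdiff) ?_
        filter_upwards [hin] with x hx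
        obtain ⟨h0, h1⟩ := hg01 x
        by_cases hxs : x ∈ s
        · have := hx hxs
          simp only [Set.indicator_of_mem hxs]
          nlinarith
        · have := hout x hxs
          simp only [Set.indicator_of_notMem hxs]
          nlinarith
    _ = ∫ x in s, w x ∂μ := by
        rw [integral_add hsw hdiff, integral_indicator hs, integral_const_mul,
          integral_sub hg hone, integral_indicator hs, hgs]
        simp

theorem integrableOn_ball_norm_rpow {N : ℕ} (hN : 1 ≤ N) {β : ℝ} (hβ : -(N : ℝ) < β) (r : ℝ) :
    IntegrableOn (fun y : EuclideanSpace ℝ (Fin N) => ‖y‖ ^ β) (ball 0 r) := by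
  refine integrableOn_ball_of_norm_le_rpow (C := 1) (α := -β) (by simpa using hN)
    (by simp only [finrank_euclideanSpace_fin]; linarith) (Filter.Eventually.of_forall fun x => ?_)
    (measurable_norm.pow_const β).aestronglyMeasurable
  rw [neg_neg, one_mul, Real.norm_of_nonneg (Real.rpow_nonneg (norm_nonneg x) β)]

theorem omegaN_pos (N : ℕ) : 0 < omegaN N :=
  ENNReal.toReal_pos (measure_ball_pos _ _ one_pos).ne' measure_ball_lt_top.ne

theorem measureReal_ball_rpow_div_omegaN {N : ℕ} (hN : N ≠ 0) {m : ℝ} (hm : 0 < m) :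
    volume.real (ball (0 : EuclideanSpace ℝ (Fin N)) ((m / omegaN N) ^ ((N : ℝ)⁻¹))) = m := by
  have hq : 0 < m / omegaN N := div_pos hm (omegaN_pos N)
  rw [measureReal_def, Measure.addHaar_ball_of_pos _ _ (Real.rpow_pos_of_pos hq _),
    finrank_euclideanSpace_fin, Real.rpow_inv_natCast_pow hq.le hN, ENNReal.toReal_mul,
    ENNReal.toReal_ofReal hq.le]
  exact div_mul_cancel₀ m (omegaN_pos N).ne'

theorem riesz_potential_function_ball_bound (N : ℕ) (hN : 2 ≤ N) (α : ℝ) (hα₁ : 1 < α)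
    (hα₂ : α < N) (g : EuclideanSpace ℝ (Fin N) → ℝ) (hg : Integrable g)
    (hg01 : ∀ y, g y ∈ Set.Icc (0 : ℝ) 1) :
    (∫ y, g y * ‖y‖ ^ (α - (N : ℝ))) ≤
      ∫ y in ball (0 : EuclideanSpace ℝ (Fin N)) (((∫ y, g y) / omegaN N) ^ ((N : ℝ)⁻¹)),
        ‖y‖ ^ (α - (N : ℝ)) := by
  have hw0 (y : EuclideanSpace ℝ (Fin N)) : 0 ≤ ‖y‖ ^ (α - (N : ℝ)) :=
    Real.rpow_nonneg (norm_nonneg y) _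
  have hg0 : 0 ≤ g := fun y => (hg01 y).1
  rcases (integral_nonneg hg0).eq_or_lt with hm | hm
  · have hgae : g =ᵐ[volume] 0 := (integral_eq_zero_iff_of_nonneg hg0 hg).1 hm.symm
    have hzero : ∫ y, g y * ‖y‖ ^ (α - (N : ℝ)) = 0 := by
      refine integral_eq_zero_of_ae ?_
      filter_upwards [hgae] with y hy
      simp [hy]
    rw [hzero]
    exact integral_nonneg hw0
  · have : Nonempty (Fin N) := ⟨⟨0, by omega⟩⟩
    have hr : 0 < ((∫ y, g y) / omegaN N) ^ ((N : ℝ)⁻¹) :=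
      Real.rpow_pos_of_pos (div_pos hm (omegaN_pos N)) _
    have hβ : α - (N : ℝ) ≤ 0 := by linarith
    refine integral_mul_le_setIntegral_of_superlevel
      (c := (((∫ y, g y) / omegaN N) ^ ((N : ℝ)⁻¹)) ^ (α - (N : ℝ)))
      measurableSet_ball measure_ball_lt_top.ne hg hg01
      (integrableOn_ball_norm_rpow (by omega) (by linarith) _) hw0 ?_ (fun y hy => ?_)
      (measureReal_ball_rpow_div_omegaN (by omega) hm).symm
    · filter_upwards [Measure.ae_ne volume 0] with y hy hyr
      exact Real.rpow_le_rpow_of_nonpos (norm_pos_iff.2 hy) (mem_ball_zero_iff.1 hyr).le hβ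
    · rw [mem_ball_zero_iff, not_lt] at hy
      exact Real.rpow_le_rpow_of_nonpos hr hy hβ
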